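/- arXiv:2011.14162 — 6 statements merged into one kernel-verified Lean document; each statement's English description precedes it below -/
import Mathlib

section
/- Let G be a finite connected simple graph with n vertices v_1,...,v_n and m edges. Let U be the 2m×2m Grover matrix of G, indexed by the arcs of G, and let T(G) be the n×n transition probability matrix of the simple random walk on G. Then for every complex number λ, det(λ I_{2m} − U) = (λ² − 1)^{m−n} · det((λ² + 1) I_n − 2λ T(G)). -/
open SimpleGraph

/-- The Grover matrix of a finite simple graph `G`, indexed by the darts (arcs) of `G`:
`U e f = 2/deg(t(f))` if `t(f) = o(e)` and `f ≠ e⁻¹`, `U e f = 2/deg(t(f)) - 1` if `f = e⁻¹`,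
and `U e f = 0` otherwise. -/
noncomputable def groverMatrix {V : Type*} [Fintype V] [DecidableEq V] (G : SimpleGraph V)
    [DecidableRel G.Adj] : Matrix G.Dart G.Dart ℂ := fun e f =>
  if f = e.symm then 2 / (G.degree f.snd : ℂ) - 1
  else if f.snd = e.fst then 2 / (G.degree f.snd : ℂ)
  else 0

/-- The transition probability matrix of the simple random walk on `G`:
`T u v = 1/deg(u)` if `(u,v)` is an arc of `G`, and `0` otherwise. -/
noncomputable def transMatrix {V : Type*} [Fintype V] [DecidableEq V] (G : SimpleGraph V)
    [DecidableRel G.Adj] : Matrix V V ℂ := fun u v =>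
  if G.Adj u v then 1 / (G.degree u : ℂ) else 0

namespace SimpleGraph

open Matrix

variable {V : Type*} [Fintype V] [DecidableEq V] (G : SimpleGraph V) [DecidableRel G.Adj]

/-- The permutation matrix of arc reversal. -/
def dartReversal : Matrix G.Dart G.Dart ℂ := fun e f => if f = e.symm then 1 else 0

/-- The incidence matrix between arcs and their origins. -/
def dartOrigin : Matrix G.Dart V ℂ := fun e v => if e.fst = v then 1 else 0

/-- The incidence matrix between arcs and their termini, with the row of `v` scaled by
`2 / deg v`. -/
noncomputable def dartTerminus : Matrix V G.Dart ℂ := fun v f =>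
  if f.snd = v then 2 / (G.degree v : ℂ) else 0

lemma groverMatrix_eq : groverMatrix G = dartOrigin G * dartTerminus G - dartReversal G := by
  ext e f
  have h : f = e.symm → f.snd = e.fst := by rintro rfl; rfl
  simp only [groverMatrix, dartOrigin, dartTerminus, dartReversal, Matrix.sub_apply, mul_apply,
    ite_mul, one_mul, zero_mul, Finset.sum_ite_eq, Finset.mem_univ, if_true]
  by_cases h1 : f = e.symm
  · rw [if_pos h1, if_pos h1, if_pos (h h1), h h1]
  · rw [if_neg h1, if_neg h1, sub_zero]
    split_ifs with h2
    · rw [h2]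
    · rfl

lemma dartReversal_mul_apply {α : Type*} (M : Matrix G.Dart α ℂ) (e : G.Dart) (a : α) :
    (dartReversal G * M) e a = M e.symm a := by
  simp [dartReversal, mul_apply]

lemma dartReversal_mul_self : dartReversal G * dartReversal G = 1 := by
  ext e f
  rw [dartReversal_mul_apply]
  simp [dartReversal, one_apply, eq_comm]

lemma dartTerminus_mul_dartOrigin : dartTerminus G * dartOrigin G = (2 : ℂ) • transMatrix G := by
  ext v w
  simp only [dartTerminus, dartOrigin, transMatrix, mul_apply, Matrix.smul_apply, smul_eq_mul,
    mul_ite, mul_one, mul_zero, ← ite_and]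
  by_cases h : G.Adj v w
  · rw [Finset.sum_eq_single (⟨(w, v), h.symm⟩ : G.Dart)]
    · simp [h]; ring
    · rintro ⟨⟨x, y⟩, hxy⟩ - hne
      rw [if_neg]
      rintro ⟨rfl, rfl⟩
      exact hne rfl
    · simp
  · rw [Finset.sum_eq_zero]
    · simp [h]
    · rintro ⟨⟨x, y⟩, hxy⟩ -
      rw [if_neg]
      rintro ⟨rfl, rfl⟩
      exact h hxy.symm

lemma dartTerminus_mul_dartReversal_mul_dartOrigin (hdeg : ∀ v, G.degree v ≠ 0) :
    dartTerminus G * (dartReversal G * dartOrigin G) = (2 : ℂ) • (1 : Matrix V V ℂ) := by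
  ext v w
  have hv : (G.degree v : ℂ) ≠ 0 := Nat.cast_ne_zero.2 (hdeg v)
  have hfiber : (Finset.univ.filter fun d : G.Dart => d.snd = v).card = G.degree v := by
    rw [← G.dart_fst_fiber_card_eq_degree v]
    refine Finset.card_bij' (fun d _ => d.symm) (fun d _ => d.symm) ?_ ?_ ?_ ?_ <;> simp
  have hentry : ∀ d : G.Dart, dartTerminus G v d * dartOrigin G d.symm w =
      if d.snd = v then (if v = w then 2 / (G.degree v : ℂ) else 0) else 0 := by
    intro d
    have hd : dartOrigin G d.symm w = if d.snd = w then 1 else 0 := rfl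
    rw [hd, dartTerminus]
    by_cases h : d.snd = v <;> simp [h]
  simp only [mul_apply (M := dartTerminus G), dartReversal_mul_apply, hentry]
  rw [← Finset.sum_filter, Finset.sum_const, hfiber, Matrix.smul_apply, one_apply]
  split_ifs
  · simp only [nsmul_eq_mul, smul_eq_mul]
    field_simp
  · simp

lemma det_fromBlocks_smul_one {ι : Type*} [Fintype ι] [DecidableEq ι] (a b : ℂ) :
    (fromBlocks (a • 1) (b • 1) (b • 1) (a • 1) : Matrix (ι ⊕ ι) (ι ⊕ ι) ℂ).det =
      (a ^ 2 - b ^ 2) ^ Fintype.card ι := by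
  have h : (fromBlocks 1 1 0 1 : Matrix (ι ⊕ ι) (ι ⊕ ι) ℂ) *
      fromBlocks (a • 1) (b • 1) (b • 1) (a • 1) * fromBlocks 1 (-1) 0 1 =
      fromBlocks ((a + b) • 1) 0 (b • 1) ((a - b) • 1) := by
    simp only [fromBlocks_multiply]
    congr 1 <;> simp <;> module
  have := congrArg det h
  simp only [det_mul, det_fromBlocks_zero₂₁, det_fromBlocks_zero₁₂, det_one, det_smul, one_mul,
    mul_one] at this
  rw [this, ← mul_pow]
  ring

lemma det_smul_one_add_smul_dartReversal (a b : ℂ) :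
    (a • (1 : Matrix G.Dart G.Dart ℂ) + b • dartReversal G).det =
      (a ^ 2 - b ^ 2) ^ G.edgeFinset.card := by
  classical
  let φ := Fintype.equivFin V
  let p : G.Dart → Prop := fun d => φ d.fst < φ d.snd
  have hp : ∀ d : G.Dart, p d ↔ ¬ p d.symm := by
    intro d
    have : φ d.fst ≠ φ d.snd := fun h => d.adj.ne (φ.injective h)
    simp only [p, Dart.symm, Prod.fst_swap, Prod.snd_swap, not_lt]
    exact ⟨le_of_lt, fun h => lt_of_le_of_ne h this⟩
  let σ : {d // p d} ≃ {d // ¬ p d} :=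
    (Equiv.ofBijective _ (Dart.symm_involutive (G := G)).bijective).subtypeEquiv fun d => by
      simpa using (hp d).trans (by rfl)
  let ψ : {d // p d} ⊕ {d // p d} ≃ G.Dart :=
    ((Equiv.refl _).sumCongr σ).trans (Equiv.sumCompl p)
  have hl : ∀ x, ψ (Sum.inl x) = x.1 := fun x => rfl
  have hr : ∀ x, ψ (Sum.inr x) = x.1.symm := fun x => rfl
  have hne : ∀ x y : {d // p d}, (y : G.Dart) ≠ (x : G.Dart).symm := fun x y h =>
    (hp x).1 x.2 (h ▸ y.2)
  have hcard : Fintype.card {d // p d} = G.edgeFinset.card := by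
    have h1 := Fintype.card_congr ψ
    rw [Fintype.card_sum, G.dart_card_eq_twice_card_edges] at h1
    omega
  rw [← det_submatrix_equiv_self ψ, ← hcard, ← det_fromBlocks_smul_one]
  congr 1
  ext (x | x) (y | y)
  · simp [hl, dartReversal, hne, one_apply, Subtype.ext_iff]
  · have h2 : (x : G.Dart) ≠ (y : G.Dart).symm := hne y x
    simp [hl, hr, dartReversal, h2, one_apply, Subtype.ext_iff, eq_comm,
      (Dart.symm_involutive (G := G)).injective.eq_iff]
  · have h2 : (x : G.Dart).symm ≠ (y : G.Dart) := (hne x y).symm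
    simp [hl, hr, dartReversal, h2, one_apply, Subtype.ext_iff, eq_comm]
  · have h2 : (y : G.Dart).symm ≠ (x : G.Dart) := (hne y x).symm
    simp [hr, dartReversal, h2, one_apply, Subtype.ext_iff,
      (Dart.symm_involutive (G := G)).injective.eq_iff]

lemma det_smul_one_sub_smul_groverMatrix_mul (hdeg : ∀ v, G.degree v ≠ 0) {a b : ℂ}
    (hab : a ^ 2 - b ^ 2 ≠ 0) :
    (a • (1 : Matrix G.Dart G.Dart ℂ) - b • groverMatrix G).det *
        (a ^ 2 - b ^ 2) ^ Fintype.card V =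
      (a ^ 2 - b ^ 2) ^ G.edgeFinset.card *
        ((a ^ 2 + b ^ 2) • (1 : Matrix V V ℂ) - (2 * a * b) • transMatrix G).det := by
  set c := a ^ 2 - b ^ 2 with hc
  set J := dartReversal G
  have hJ : (a • (1 : Matrix G.Dart G.Dart ℂ) + b • J) * (a • 1 - b • J) = c • 1 := by
    simp only [add_mul, mul_sub, smul_mul_smul_comm, one_mul, mul_one, J,
      dartReversal_mul_self, hc]
    module
  have hfactor : a • (1 : Matrix G.Dart G.Dart ℂ) - b • groverMatrix G =
      (a • 1 + b • J) *
        (1 - ((c⁻¹ * b) • ((a • 1 - b • J) * dartOrigin G)) * dartTerminus G) := by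
    rw [mul_sub, mul_one, Matrix.smul_mul, Matrix.mul_smul, Matrix.mul_assoc, ← Matrix.mul_assoc,
      hJ, Matrix.smul_mul, Matrix.one_mul, smul_smul, groverMatrix_eq, mul_right_comm, inv_mul_cancel₀ hab]
    module
  have hsmall : dartTerminus G * ((c⁻¹ * b) • ((a • 1 - b • J) * dartOrigin G)) =
      (c⁻¹ * b) • ((2 * a) • transMatrix G - (2 * b) • 1) := by
    rw [Matrix.mul_smul, Matrix.sub_mul, Matrix.smul_mul, Matrix.smul_mul, Matrix.one_mul,
      Matrix.mul_sub, Matrix.mul_smul, Matrix.mul_smul, dartTerminus_mul_dartOrigin, dartTerminus_mul_dartReversal_mul_dartOrigin G hdeg]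
    module
  have hscale : (a ^ 2 + b ^ 2) • (1 : Matrix V V ℂ) - (2 * a * b) • transMatrix G =
      c • (1 - (c⁻¹ * b) • ((2 * a) • transMatrix G - (2 * b) • 1)) := by
    rw [smul_sub, smul_smul, mul_inv_cancel_left₀ hab, hc]
    module
  rw [hfactor, det_mul, det_one_sub_mul_comm, hsmall, hscale, det_smul,
    det_smul_one_add_smul_dartReversal]
  ring

lemma det_sub_groverMatrix_mul (hdeg : ∀ v, G.degree v ≠ 0) {a : ℂ} (ha : a ^ 2 - 1 ≠ 0) :
    (a • (1 : Matrix G.Dart G.Dart ℂ) - groverMatrix G).det * (a ^ 2 - 1) ^ Fintype.card V =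
      (a ^ 2 - 1) ^ G.edgeFinset.card *
        ((a ^ 2 + 1) • (1 : Matrix V V ℂ) - (2 * a) • transMatrix G).det := by
  simpa using det_smul_one_sub_smul_groverMatrix_mul G hdeg (a := a) (b := 1) (by simpa using ha)

lemma dense_sq_sub_one_ne_zero : Dense {a : ℂ | a ^ 2 - 1 ≠ 0} := by
  refine (Set.Countable.dense_compl ℂ (Set.toFinite ({1, -1} : Set ℂ)).countable).mono ?_
  intro a ha h
  exact ha (by simpa using sub_eq_zero.1 h)

lemma det_sub_groverMatrix_of_card_le (hdeg : ∀ v, G.degree v ≠ 0)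
    (hcard : Fintype.card V ≤ G.edgeFinset.card) (a : ℂ) :
    (a • (1 : Matrix G.Dart G.Dart ℂ) - groverMatrix G).det =
      (a ^ 2 - 1) ^ (G.edgeFinset.card - Fintype.card V) *
        ((a ^ 2 + 1) • (1 : Matrix V V ℂ) - (2 * a) • transMatrix G).det := by
  refine congrFun (Continuous.ext_on dense_sq_sub_one_ne_zero
    (f := fun a : ℂ => (a • (1 : Matrix G.Dart G.Dart ℂ) - groverMatrix G).det)
    (g := fun a : ℂ => (a ^ 2 - 1) ^ (G.edgeFinset.card - Fintype.card V) *
        ((a ^ 2 + 1) • (1 : Matrix V V ℂ) - (2 * a) • transMatrix G).det)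
    (by fun_prop) (by fun_prop) fun x hx => ?_) a
  refine mul_right_cancel₀ (pow_ne_zero (Fintype.card V) hx) ?_
  rw [det_sub_groverMatrix_mul G hdeg hx]
  nth_rewrite 1 [← Nat.sub_add_cancel hcard]
  rw [pow_add]
  ring

/-- On a tree the arc determinant is antisymmetric under exchange of the homogeneous variables. -/
lemma det_smul_one_sub_groverMatrix_antisymm (hdeg : ∀ v, G.degree v ≠ 0)
    (hcard : Fintype.card V = G.edgeFinset.card + 1) (a : ℂ) :
    (a • (1 : Matrix G.Dart G.Dart ℂ) - groverMatrix G).det =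
      -((1 : Matrix G.Dart G.Dart ℂ) - a • groverMatrix G).det := by
  refine congrFun (Continuous.ext_on dense_sq_sub_one_ne_zero
    (f := fun a : ℂ => (a • (1 : Matrix G.Dart G.Dart ℂ) - groverMatrix G).det)
    (g := fun a : ℂ => -((1 : Matrix G.Dart G.Dart ℂ) - a • groverMatrix G).det)
    (by fun_prop) (by fun_prop) fun x hx => ?_) a
  have hx' : (1 : ℂ) ^ 2 - x ^ 2 ≠ 0 := by
    rw [one_pow, ← neg_sub]
    exact neg_ne_zero.2 hx
  have h1 := det_sub_groverMatrix_mul G hdeg hx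
  have h2 := det_smul_one_sub_smul_groverMatrix_mul G hdeg hx'
  rw [hcard, pow_succ, mul_comm, mul_assoc] at h1 h2
  replace h1 := mul_left_cancel₀ (pow_ne_zero _ hx) h1
  replace h2 := mul_left_cancel₀ (pow_ne_zero _ hx') h2
  rw [one_smul, show (1 : ℂ) ^ 2 + x ^ 2 = x ^ 2 + 1 by ring,
    show 2 * (1 : ℂ) * x = 2 * x by ring, ← h1] at h2
  refine mul_left_cancel₀ hx ?_
  linear_combination -h2

lemma det_sub_groverMatrix_eq_zero (hdeg : ∀ v, G.degree v ≠ 0)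
    (hcard : Fintype.card V = G.edgeFinset.card + 1) {a : ℂ} (ha : a ^ 2 = 1) :
    (a • (1 : Matrix G.Dart G.Dart ℂ) - groverMatrix G).det = 0 := by
  have h := det_smul_one_sub_groverMatrix_antisymm G hdeg hcard a
  have hscale : (1 : Matrix G.Dart G.Dart ℂ) - a • groverMatrix G =
      a • (a • (1 : Matrix G.Dart G.Dart ℂ) - groverMatrix G) := by
    rw [smul_sub, smul_smul, ← sq, ha, one_smul]
  rw [hscale, det_smul, G.dart_card_eq_twice_card_edges, pow_mul, ha, one_pow, one_mul] at h
  exact self_eq_neg.1 h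

end SimpleGraph

/-- Konno–Sato theorem: for a finite connected simple graph `G` with `n` vertices and `m` edges,
`det(λ I_{2m} - U) = (λ² - 1)^(m - n) · det((λ² + 1) I_n - 2λ T(G))`,
where the exponent `m - n` is an integer (possibly `-1`, for a tree). -/
theorem grover_char_poly_transition {V : Type*} [Fintype V] [DecidableEq V]
    (G : SimpleGraph V) [DecidableRel G.Adj]
    (hG : G.Connected) (hV : 2 ≤ Fintype.card V)
    (n m : ℕ) (hn : n = Fintype.card V) (hm : m = G.edgeFinset.card) (lam : ℂ) :
    Matrix.det (lam • (1 : Matrix G.Dart G.Dart ℂ) - groverMatrix G) =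
      (lam ^ 2 - 1) ^ ((m : ℤ) - (n : ℤ)) *
        Matrix.det ((lam ^ 2 + 1) • (1 : Matrix V V ℂ) - (2 * lam) • transMatrix G) := by
  subst hn hm
  have : Nontrivial V := Fintype.one_lt_card_iff_nontrivial.1 hV
  have hdeg : ∀ v, G.degree v ≠ 0 := fun v => (hG.preconnected.degree_pos_of_nontrivial v).ne'
  have hle : Fintype.card V ≤ G.edgeFinset.card + 1 := by
    simpa only [Nat.card_eq_fintype_card, ← edgeFinset_card] using
      hG.card_vert_le_card_edgeSet_add_one
  rcases hle.lt_or_eq with hlt | heq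
  · rw [det_sub_groverMatrix_of_card_le G hdeg (Nat.lt_succ_iff.1 hlt), ← zpow_natCast,
      Nat.cast_sub (Nat.lt_succ_iff.1 hlt)]
  · by_cases hlam : lam ^ 2 - 1 = 0
    · rw [det_sub_groverMatrix_eq_zero G hdeg heq (sub_eq_zero.1 hlam), hlam,
        zero_zpow _ (by omega), zero_mul]
    · rw [zpow_sub₀ hlam, zpow_natCast, zpow_natCast, div_mul_eq_mul_div,
        ← det_sub_groverMatrix_mul G hdeg hlam, mul_div_cancel_right₀ _ (pow_ne_zero _ hlam)]
end

section
/- Let G be a finite connected simple graph with n vertices v_1,...,v_n and m edges. Let U be the 2m×2m Grover matrix of G, let A(G) be the adjacency matrix of G, and let D be the diagonal degree matrix with D_{ii} = deg(v_i). Then for every complex number λ, det(λ I_{2m} − U) = (λ² − 1)^{m−n} · det((λ² + 1) D − 2λ A(G)) / (deg(v_1) ⋯ deg(v_n)). -/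
open SimpleGraph

open Matrix in
theorem Matrix.det_fromBlocks_smul_one {k R : Type*} [Fintype k] [DecidableEq k] [CommRing R]
    (x : R) :
    (fromBlocks (x • 1) 1 1 (x • 1) : Matrix (k ⊕ k) (k ⊕ k) R).det =
      (x ^ 2 - 1) ^ Fintype.card k := by
  have h : (fromBlocks 1 0 (-1) 1 : Matrix (k ⊕ k) (k ⊕ k) R) *
      (fromBlocks (x • 1) 1 1 (x • 1) * fromBlocks 1 0 1 1) =
        fromBlocks ((x + 1) • 1) 1 0 ((x - 1) • 1) := by
    simp [fromBlocks_multiply, add_smul, sub_smul, neg_add_eq_sub]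
    abel
  have h' := congrArg det h
  simp only [det_mul, det_fromBlocks_zero₁₂, det_fromBlocks_zero₂₁, det_one, det_smul, one_mul,
    mul_one] at h'
  rw [h', ← mul_pow]
  ring

namespace SimpleGraph

variable {V : Type*} [Fintype V] [DecidableEq V] (G : SimpleGraph V) [DecidableRel G.Adj]

/-- The permutation matrix of the arc reversal. -/
def dartSymmMatrix : Matrix G.Dart G.Dart ℂ := fun e f => if f = e.symm then 1 else 0

/-- The incidence matrix of arcs and their origins. -/
def dartFstMatrix : Matrix G.Dart V ℂ := fun e v => if e.fst = v then 1 else 0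

/-- The incidence matrix of arcs and their terminal vertices, scaled by `2 / deg`. -/
noncomputable def dartSndMatrix : Matrix V G.Dart ℂ :=
  fun v f => if f.snd = v then 2 / (G.degree v : ℂ) else 0

theorem groverMatrix_eq_s1 :
    groverMatrix G = G.dartFstMatrix * G.dartSndMatrix - G.dartSymmMatrix := by
  ext e f
  by_cases h1 : f = e.symm
  · subst h1
    simp [groverMatrix, dartFstMatrix, dartSndMatrix, dartSymmMatrix, Matrix.mul_apply]
    rfl
  · by_cases h2 : f.snd = e.fst
    · simp [groverMatrix, dartFstMatrix, dartSndMatrix, dartSymmMatrix, Matrix.mul_apply, h1, h2]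
      exact congrArg (fun v => 2 / (G.degree v : ℂ)) h2
    · simp [groverMatrix, dartFstMatrix, dartSndMatrix, dartSymmMatrix, Matrix.mul_apply, h1, h2,
        Ne.symm h2]

theorem dartSymmMatrix_mul {k : Type*} (M : Matrix G.Dart k ℂ) :
    G.dartSymmMatrix * M = M.submatrix Dart.symm id := by
  ext e f
  simp [dartSymmMatrix, Matrix.mul_apply]

theorem dartSymmMatrix_mul_self : G.dartSymmMatrix * G.dartSymmMatrix = 1 := by
  rw [dartSymmMatrix_mul]
  ext e f
  simp [dartSymmMatrix, Matrix.one_apply, eq_comm]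

theorem det_smul_one_add_dartSymmMatrix (x : ℂ) :
    (x • (1 : Matrix G.Dart G.Dart ℂ) + G.dartSymmMatrix).det =
      (x ^ 2 - 1) ^ G.edgeFinset.card := by
  let r := Fintype.equivFin V
  let P := {d : G.Dart // r d.fst < r d.snd}
  let g : P ⊕ P → G.Dart := Sum.elim Subtype.val (fun d => d.1.symm)
  have hP : ∀ a b : P, a.1 ≠ b.1.symm := by
    intro a b h
    have ha := a.2
    rw [h] at ha
    exact lt_asymm ha b.2
  have hg : Function.Bijective g := by
    constructor
    · rintro (a | a) (b | b) h
      · exact congrArg Sum.inl (Subtype.ext h)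
      · exact absurd h (hP a b)
      · exact absurd h.symm (hP b a)
      · exact congrArg Sum.inr (Subtype.ext (Dart.symm_involutive.injective h))
    · intro d
      rcases lt_trichotomy (r d.fst) (r d.snd) with h | h | h
      · exact ⟨Sum.inl ⟨d, h⟩, rfl⟩
      · exact absurd (r.injective h) d.fst_ne_snd
      · exact ⟨Sum.inr ⟨d.symm, h⟩, d.symm_symm⟩
  have hcard : Fintype.card P = G.edgeFinset.card := by
    have h1 := Fintype.card_of_bijective hg
    rw [Fintype.card_sum, G.dart_card_eq_twice_card_edges] at h1
    omega
  rw [← hcard, ← Matrix.det_fromBlocks_smul_one,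
    ← Matrix.det_submatrix_equiv_self (Equiv.ofBijective g hg)]
  congr 1
  ext (a | a) (b | b)
  · simp [g, dartSymmMatrix, Matrix.one_apply, ← Subtype.ext_iff, hP]
  · simp [g, dartSymmMatrix, Matrix.one_apply, ← Subtype.ext_iff, hP,
      Dart.symm_involutive.injective.eq_iff, eq_comm]
  · simp [g, dartSymmMatrix, Matrix.one_apply, ← Subtype.ext_iff, (hP _ _).symm, eq_comm]
  · simp [g, dartSymmMatrix, Matrix.one_apply, ← Subtype.ext_iff, (hP _ _).symm,
      Dart.symm_involutive.injective.eq_iff]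

theorem sum_dart_fst_snd (v w : V) (c : ℂ) :
    ∑ d : G.Dart, (if d.snd = v then if d.fst = w then c else 0 else 0) =
      if G.Adj v w then c else 0 := by
  by_cases h : G.Adj v w
  · rw [Finset.sum_eq_single ⟨(w, v), h.symm⟩]
    · simp [h]
    · intro d _ hd
      split_ifs with h1 h2 <;> first | rfl | exact absurd (Dart.ext _ _ (Prod.ext h2 h1)) hd
    · simp
  · rw [if_neg h]
    refine Finset.sum_eq_zero fun d _ => ?_
    split_ifs with h1 h2 <;> first | rfl | (subst h1 h2; exact absurd d.adj.symm h)

theorem sum_dart_snd (v : V) (c : ℂ) :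
    ∑ d : G.Dart, (if d.snd = v then c else 0) = G.degree v * c := by
  rw [← G.dart_fst_fiber_card_eq_degree v, ← nsmul_eq_mul, ← Finset.sum_const, Finset.sum_filter]
  exact Fintype.sum_equiv Dart.symm_involutive.toPerm _ _ fun d => rfl

theorem dartSndMatrix_mul_dartFstMatrix :
    G.dartSndMatrix * G.dartFstMatrix =
      Matrix.diagonal (fun v => 2 / (G.degree v : ℂ)) * G.adjMatrix ℂ := by
  ext v w
  have h (d : G.Dart) : G.dartSndMatrix v d * G.dartFstMatrix d w =
      if d.snd = v then if d.fst = w then 2 / (G.degree v : ℂ) else 0 else 0 := by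
    simp [dartSndMatrix, dartFstMatrix, ← ite_and, and_comm]
  rw [Matrix.mul_apply, Finset.sum_congr rfl fun d _ => h d, sum_dart_fst_snd,
    Matrix.diagonal_mul, adjMatrix_apply, mul_ite, mul_one, mul_zero]

theorem dartSndMatrix_mul_dartSymmMatrix_mul_dartFstMatrix (hdeg : ∀ v, (G.degree v : ℂ) ≠ 0) :
    G.dartSndMatrix * (G.dartSymmMatrix * G.dartFstMatrix) = (2 : ℂ) • 1 := by
  rw [dartSymmMatrix_mul]
  ext v w
  have h (d : G.Dart) : G.dartSndMatrix v d * G.dartFstMatrix.submatrix Dart.symm id d w =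
      if d.snd = v then (if v = w then 2 / (G.degree v : ℂ) else 0) else 0 := by
    by_cases hd : d.snd = v <;> simp [dartSndMatrix, dartFstMatrix, hd]
  have := hdeg v
  simp only [Matrix.mul_apply, h, sum_dart_snd, Matrix.smul_apply, Matrix.one_apply]
  split_ifs
  · simp; field_simp
  · simp

theorem det_smul_one_sub_groverMatrix_of_ne (hdeg : ∀ v, (G.degree v : ℂ) ≠ 0) {x : ℂ}
    (hx : x ^ 2 - 1 ≠ 0) :
    (x • (1 : Matrix G.Dart G.Dart ℂ) - groverMatrix G).det =
      (x ^ 2 - 1) ^ ((G.edgeFinset.card : ℤ) - (Fintype.card V : ℤ)) *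
        Matrix.det ((x ^ 2 + 1) • Matrix.diagonal (fun v => (G.degree v : ℂ))
            - (2 * x) • G.adjMatrix ℂ)
          / ∏ v : V, (G.degree v : ℂ) := by
  have hinv : (x • (1 : Matrix G.Dart G.Dart ℂ) + G.dartSymmMatrix)⁻¹ =
      (x ^ 2 - 1)⁻¹ • (x • 1 - G.dartSymmMatrix) := by
    apply Matrix.inv_eq_right_inv
    have : (x • (1 : Matrix G.Dart G.Dart ℂ) + G.dartSymmMatrix) * (x • 1 - G.dartSymmMatrix) =
        (x ^ 2 - 1) • 1 := by
      simp only [add_mul, mul_sub, smul_mul_assoc, mul_smul_comm, one_mul, mul_one,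
        dartSymmMatrix_mul_self]
      module
    rw [Matrix.mul_smul, this, smul_smul, inv_mul_cancel₀ hx, one_smul]
  have hU : x • (1 : Matrix G.Dart G.Dart ℂ) - groverMatrix G =
      (x • 1 + G.dartSymmMatrix) + (-G.dartFstMatrix) * G.dartSndMatrix := by
    rw [groverMatrix_eq_s1, Matrix.neg_mul]; abel
  have hdet := G.det_smul_one_add_dartSymmMatrix x
  have hunit : IsUnit (x • (1 : Matrix G.Dart G.Dart ℂ) + G.dartSymmMatrix).det := by
    rw [hdet]; exact (pow_ne_zero _ hx).isUnit
  have hdiag : Matrix.diagonal (fun v => (G.degree v : ℂ)) *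
      Matrix.diagonal (fun v => 2 / (G.degree v : ℂ)) = (2 : ℂ) • 1 := by
    rw [Matrix.diagonal_mul_diagonal, Matrix.smul_one_eq_diagonal]
    congr 1
    ext v
    exact mul_div_cancel₀ _ (hdeg v)
  have hsmall : Matrix.diagonal (fun v => (G.degree v : ℂ)) * (1 + G.dartSndMatrix *
      (x • (1 : Matrix G.Dart G.Dart ℂ) + G.dartSymmMatrix)⁻¹ * (-G.dartFstMatrix)) =
      (x ^ 2 - 1)⁻¹ • ((x ^ 2 + 1) • Matrix.diagonal (fun v => (G.degree v : ℂ))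
            - (2 * x) • G.adjMatrix ℂ) := by
    have : G.dartSndMatrix * (x • (1 : Matrix G.Dart G.Dart ℂ) + G.dartSymmMatrix)⁻¹ *
        (-G.dartFstMatrix) = (x ^ 2 - 1)⁻¹ • ((2 : ℂ) • 1 -
          x • (Matrix.diagonal (fun v => 2 / (G.degree v : ℂ)) * G.adjMatrix ℂ)) := by
      rw [← dartSndMatrix_mul_dartFstMatrix,
        ← G.dartSndMatrix_mul_dartSymmMatrix_mul_dartFstMatrix hdeg, hinv]
      simp only [Matrix.mul_smul, Matrix.smul_mul, Matrix.mul_sub, Matrix.sub_mul, Matrix.mul_neg,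
        Matrix.mul_one, Matrix.mul_assoc]
      module
    rw [this, Matrix.mul_add, Matrix.mul_smul, Matrix.mul_sub, Matrix.mul_smul, Matrix.mul_smul,
      ← Matrix.mul_assoc, hdiag, Matrix.smul_mul, Matrix.mul_one, Matrix.one_mul]
    match_scalars
    · field_simp
      ring
    · field_simp
  have hsdet := congrArg Matrix.det hsmall
  rw [Matrix.det_mul, Matrix.det_diagonal, Matrix.det_smul] at hsdet
  have hprod : ∏ v : V, (G.degree v : ℂ) ≠ 0 := Finset.prod_ne_zero_iff.mpr fun v _ => hdeg v
  rw [hU, Matrix.det_add_mul _ _ hunit, hdet, eq_div_iff hprod, mul_assoc, mul_comm (Matrix.det _),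
    hsdet, zpow_sub₀ hx, zpow_natCast, zpow_natCast, inv_pow]
  ring

theorem groverMatrix_mulVec_of_fst {g : V → ℂ} {c : ℂ} (hdeg : ∀ v, (G.degree v : ℂ) ≠ 0)
    (hg : ∀ v w, G.Adj v w → g v = c * g w) :
    (groverMatrix G).mulVec (fun d => g d.fst) = c • fun d => g d.fst := by
  ext e
  have hS : G.dartSndMatrix.mulVec (fun d => g d.fst) = fun v => 2 * (c * g v) := by
    ext v
    have h (d : G.Dart) : G.dartSndMatrix v d * g d.fst =
        if d.snd = v then 2 / (G.degree v : ℂ) * (c * g v) else 0 := by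
      by_cases hd : d.snd = v
      · simp [dartSndMatrix, hd, hg _ _ d.adj]
      · simp [dartSndMatrix, hd]
    have := hdeg v
    simp only [Matrix.mulVec, dotProduct, h, sum_dart_snd]
    field_simp
  rw [groverMatrix_eq_s1, Matrix.sub_mulVec, ← Matrix.mulVec_mulVec, hS]
  have h2 := hg _ _ e.adj.symm
  simp [Matrix.mulVec, dotProduct, dartFstMatrix, dartSymmMatrix, h2]
  ring

theorem det_smul_one_sub_groverMatrix_eq_zero [Nonempty G.Dart] {g : V → ℂ} {c : ℂ}
    (hdeg : ∀ v, (G.degree v : ℂ) ≠ 0) (hg0 : ∀ v, g v ≠ 0)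
    (hg : ∀ v w, G.Adj v w → g v = c * g w) :
    (c • (1 : Matrix G.Dart G.Dart ℂ) - groverMatrix G).det = 0 := by
  refine Matrix.exists_mulVec_eq_zero_iff.mp ⟨fun d => g d.fst, ?_, ?_⟩
  · intro h
    obtain ⟨d⟩ := ‹Nonempty G.Dart›
    exact hg0 _ (congrFun h d)
  · rw [Matrix.sub_mulVec, G.groverMatrix_mulVec_of_fst hdeg hg, Matrix.smul_mulVec,
      Matrix.one_mulVec, sub_self]

end SimpleGraph

/-- Konno–Sato theorem, adjacency-matrix form: for a finite connected simple graph `G` with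
`n` vertices and `m` edges,
`det(λ I_{2m} - U) = (λ² - 1)^(m - n) · det((λ² + 1) D - 2λ A(G)) / (deg v₁ ⋯ deg vₙ)`,
where `D` is the diagonal degree matrix and the exponent `m - n` is an integer. -/
theorem grover_char_poly_adjacency {V : Type*} [Fintype V] [DecidableEq V]
    (G : SimpleGraph V) [DecidableRel G.Adj]
    (hG : G.Connected) (hV : 2 ≤ Fintype.card V)
    (n m : ℕ) (hn : n = Fintype.card V) (hm : m = G.edgeFinset.card) (lam : ℂ) :
    Matrix.det (lam • (1 : Matrix G.Dart G.Dart ℂ) - groverMatrix G) =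
      (lam ^ 2 - 1) ^ ((m : ℤ) - (n : ℤ)) *
        Matrix.det ((lam ^ 2 + 1) • Matrix.diagonal (fun v => (G.degree v : ℂ))
            - (2 * lam) • G.adjMatrix ℂ)
          / ∏ v : V, (G.degree v : ℂ) := by
  subst hn hm
  have : Nontrivial V := Fintype.one_lt_card_iff_nontrivial.mp hV
  have hdeg (v : V) : (G.degree v : ℂ) ≠ 0 :=
    Nat.cast_ne_zero.mpr (hG.preconnected.degree_pos_of_nontrivial v).ne'
  by_cases hx : lam ^ 2 - 1 ≠ 0
  · exact G.det_smul_one_sub_groverMatrix_of_ne hdeg hx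
  rcases le_or_gt (Fintype.card V) G.edgeFinset.card with hle | hlt
  · have hexp : ((G.edgeFinset.card : ℤ) - (Fintype.card V : ℤ)) =
        ((G.edgeFinset.card - Fintype.card V : ℕ) : ℤ) := (Nat.cast_sub hle).symm
    have key (x : ℂ) (h : x ^ 2 - 1 ≠ 0) := G.det_smul_one_sub_groverMatrix_of_ne hdeg h
    rw [hexp] at key ⊢
    simp only [zpow_natCast] at key ⊢
    have hdense : Dense ({1, -1} : Set ℂ)ᶜ :=
      Set.Countable.dense_compl ℂ (Set.toFinite _).countable
    refine congrFun (Continuous.ext_on hdense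
      (f := fun x : ℂ => (x • (1 : Matrix G.Dart G.Dart ℂ) - groverMatrix G).det)
      (g := fun x : ℂ => (x ^ 2 - 1) ^ (G.edgeFinset.card - Fintype.card V) *
        Matrix.det ((x ^ 2 + 1) • Matrix.diagonal (fun v => (G.degree v : ℂ))
            - (2 * x) • G.adjMatrix ℂ) / ∏ v : V, (G.degree v : ℂ)) ?_ ?_ ?_) lam
    · exact Continuous.matrix_det (by fun_prop)
    · exact (Continuous.mul (by fun_prop) (Continuous.matrix_det (by fun_prop))).div_const _
    · intro x hx'
      exact key x fun h => hx' (mul_self_eq_one_iff.mp ((pow_two _).symm.trans (sub_eq_zero.mp h)))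
  · have hle := hG.card_vert_le_card_edgeSet_add_one
    rw [Nat.card_eq_fintype_card, Nat.card_eq_fintype_card, ← edgeFinset_card] at hle
    have htree : G.IsTree := isTree_iff_connected_and_card.mpr ⟨hG, by
      rw [Nat.card_eq_fintype_card, Nat.card_eq_fintype_card, ← edgeFinset_card]; omega⟩
    have hne : Nonempty G.Dart := by
      obtain ⟨w, hw⟩ := (G.degree_pos_iff_exists_adj (Classical.arbitrary V)).mp
        (hG.preconnected.degree_pos_of_nontrivial _)
      exact ⟨⟨(_, w), hw⟩⟩
    rw [not_not] at hx
    rw [hx, zero_zpow _ (by omega), zero_mul, zero_div]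
    rcases mul_self_eq_one_iff.mp ((pow_two _).symm.trans (sub_eq_zero.mp hx)) with rfl | rfl
    · exact G.det_smul_one_sub_groverMatrix_eq_zero (g := fun _ => 1) hdeg (by simp) (by simp)
    · let C := htree.coloringTwo
      refine G.det_smul_one_sub_groverMatrix_eq_zero (g := fun v => if C v = 0 then 1 else -1) hdeg
        (fun v => by split_ifs <;> simp) (fun v w h => ?_)
      have hC : C v ≠ C w := C.valid h
      split_ifs <;> first | (exfalso; omega) | simp
end

section
/- Let G be a finite connected simple graph with n vertices and m edges, let U be its 2m×2m Grover matrix and T(G) its n×n transition probability matrix. Then for every complex number u, det(I_{2m} − u U) = (1 − u²)^{m−n} · det((1 + u²) I_n − 2u T(G)). -/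
open SimpleGraph

namespace SimpleGraph

open Matrix

section GroverMatrix

variable {V : Type*} [Fintype V] [DecidableEq V] (G : SimpleGraph V)

/-- The permutation matrix of the arc reversal `e ↦ e⁻¹`. -/
def dartReversalMatrix : Matrix G.Dart G.Dart ℂ := fun e f =>
  if f = e.symm then 1 else 0

/-- The incidence matrix between arcs and their origins. -/
def dartOriginMatrix : Matrix G.Dart V ℂ := fun e v =>
  if v = e.fst then 1 else 0

variable [DecidableRel G.Adj]

/-- The incidence matrix between vertices and the arcs ending there, with the row of `v` scaled by
`2 / deg v`. -/
noncomputable def dartTerminusMatrix : Matrix V G.Dart ℂ := fun v f =>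
  if f.snd = v then 2 / (G.degree v : ℂ) else 0

theorem groverMatrix_eq_sub :
    groverMatrix G = G.dartOriginMatrix * G.dartTerminusMatrix - G.dartReversalMatrix := by
  ext e f
  simp only [groverMatrix, dartOriginMatrix, dartTerminusMatrix, dartReversalMatrix,
    Matrix.sub_apply, Matrix.mul_apply, ite_mul, one_mul, zero_mul, Finset.sum_ite_eq',
    Finset.mem_univ, if_true]
  by_cases h : f = e.symm
  · subst h
    simp
    rfl
  · by_cases h' : f.snd = e.fst
    · simpa [h, h'] using congrArg (fun v => 2 / (G.degree v : ℂ)) h'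
    · simp [h, h']

theorem dartReversalMatrix_mul_self :
    G.dartReversalMatrix * G.dartReversalMatrix = 1 := by
  ext e f
  rw [Matrix.mul_apply, Finset.sum_eq_single e.symm]
  · simp [dartReversalMatrix, Matrix.one_apply, eq_comm]
  · intro g _ hg
    simp [dartReversalMatrix, hg]
  · simp

theorem dartReversalMatrix_mul_dartOriginMatrix_apply (e : G.Dart) (v : V) :
    (G.dartReversalMatrix * G.dartOriginMatrix) e v = if v = e.snd then 1 else 0 := by
  rw [Matrix.mul_apply, Finset.sum_eq_single e.symm]
  · simp [dartReversalMatrix, dartOriginMatrix]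
  · intro g _ hg
    simp [dartReversalMatrix, hg]
  · simp

theorem dartTerminusMatrix_mul_dartOriginMatrix :
    G.dartTerminusMatrix * G.dartOriginMatrix = (2 : ℂ) • transMatrix G := by
  ext v w
  simp only [dartTerminusMatrix, dartOriginMatrix, transMatrix, Matrix.mul_apply,
    Matrix.smul_apply, smul_eq_mul]
  by_cases h : G.Adj v w
  · rw [Fintype.sum_eq_single (⟨(w, v), h.symm⟩ : G.Dart)]
    · simp [h, div_eq_mul_inv]
    · intro f hf
      by_cases h1 : f.snd = v
      · have h2 : w ≠ f.fst := by
          rintro rfl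
          exact hf (by ext <;> simp [h1])
        simp [h2]
      · simp [h1]
  · rw [if_neg h, mul_zero]
    refine Finset.sum_eq_zero fun f _ => ?_
    by_cases h1 : f.snd = v
    · have h2 : w ≠ f.fst := by
        rintro rfl
        exact h (h1 ▸ f.adj.symm)
      simp [h2]
    · simp [h1]

theorem card_filter_dart_snd (v : V) :
    (Finset.univ.filter fun f : G.Dart => f.snd = v).card = G.degree v := by
  rw [← G.dart_fst_fiber_card_eq_degree v]
  refine Finset.card_bij' (fun f _ => f.symm) (fun f _ => f.symm) ?_ ?_ ?_ ?_ <;> simp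

theorem dartTerminusMatrix_mul_reversal_mul_origin (hdeg : ∀ v, G.degree v ≠ 0) :
    G.dartTerminusMatrix * (G.dartReversalMatrix * G.dartOriginMatrix) = (2 : ℂ) • 1 := by
  ext v w
  rw [Matrix.mul_apply]
  simp only [dartReversalMatrix_mul_dartOriginMatrix_apply, dartTerminusMatrix, Matrix.smul_apply,
    smul_eq_mul]
  have hd : (G.degree v : ℂ) ≠ 0 := by exact_mod_cast hdeg v
  by_cases h : v = w
  · subst h
    have : ∀ f : G.Dart, ((if f.snd = v then 2 / (G.degree v : ℂ) else 0) *
        if v = f.snd then 1 else 0) = if f.snd = v then 2 / (G.degree v : ℂ) else 0 := by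
      intro f
      by_cases h : f.snd = v
      · simp [h]
      · simp [h]
    simp only [this]
    rw [← Finset.sum_filter, Finset.sum_const, card_filter_dart_snd, nsmul_eq_mul,
      Matrix.one_apply_eq]
    field_simp
  · rw [Matrix.one_apply_ne h, mul_zero]
    refine Finset.sum_eq_zero fun f _ => ?_
    by_cases h1 : f.snd = v
    · have h2 : w ≠ f.snd := fun h2 => h (h1.symm.trans h2.symm)
      simp [h2]
    · simp [h1]

theorem det_one_add_smul_dartReversalMatrix (u : ℂ) :
    (1 + u • G.dartReversalMatrix).det = (1 - u ^ 2) ^ G.edgeFinset.card := by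
  classical
  let φ := Fintype.equivFin V
  let P := {e : G.Dart // φ e.fst < φ e.snd}
  have hne : ∀ e : G.Dart, φ e.fst ≠ φ e.snd := fun e h => e.adj.ne (φ.injective h)
  let g : P ⊕ P → G.Dart := Sum.elim (fun e => e.1) fun e => e.1.symm
  have hns : ∀ a b : P, a.1 ≠ b.1.symm := fun a b h => by
    have ha := a.2
    rw [h] at ha
    exact lt_asymm ha b.2
  have hval : ∀ a b : P, a.1 = b.1 ↔ a = b := fun a b => Subtype.ext_iff.symm
  have hg : Function.Bijective g := by
    constructor
    · rintro (a | a) (b | b) h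
      · exact congrArg Sum.inl (Subtype.ext h)
      · exact absurd h (hns a b)
      · exact absurd h.symm (hns b a)
      · exact congrArg Sum.inr (Subtype.ext (Dart.symm_involutive.injective h))
    · intro e
      rcases lt_or_gt_of_ne (hne e) with h | h
      · exact ⟨Sum.inl ⟨e, h⟩, rfl⟩
      · exact ⟨Sum.inr ⟨e.symm, h⟩, e.symm_symm⟩
  let E := Equiv.ofBijective g hg
  have hcard : Fintype.card P = G.edgeFinset.card := by
    have h := Fintype.card_congr E
    rw [Fintype.card_sum, G.dart_card_eq_twice_card_edges] at h
    omega
  have hblock : (1 + u • G.dartReversalMatrix).submatrix E E =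
      fromBlocks (1 : Matrix P P ℂ) (u • 1) (u • 1) 1 := by
    ext (a | a) (b | b)
    · have := hns b a
      simp [E, g, dartReversalMatrix, Matrix.one_apply, ← hval, this]
    · have := hns a b
      simp [E, g, dartReversalMatrix, Matrix.one_apply, ← hval, this,
        Dart.symm_involutive.injective.eq_iff, eq_comm]
    · have := (hns b a).symm
      simp [E, g, dartReversalMatrix, Matrix.one_apply, ← hval, this, eq_comm]
    · have := (hns a b).symm
      simp [E, g, dartReversalMatrix, Matrix.one_apply, ← hval, this,
        Dart.symm_involutive.injective.eq_iff]
  have hs : (1 : Matrix P P ℂ) - (u • 1) * (u • 1) = (1 - u ^ 2) • 1 := by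
    rw [smul_mul_smul_comm, mul_one, sub_smul, one_smul, sq]
  rw [← det_submatrix_equiv_self E, hblock, det_fromBlocks_one₁₁, hs, det_smul, det_one, mul_one,
    hcard]

theorem det_one_sub_smul_groverMatrix_of_ne_zero (hdeg : ∀ v, G.degree v ≠ 0) {u : ℂ}
    (hu : 1 - u ^ 2 ≠ 0) :
    (1 - u • groverMatrix G).det = (1 - u ^ 2) ^ ((G.edgeFinset.card : ℤ) - Fintype.card V) *
      ((1 + u ^ 2) • (1 : Matrix V V ℂ) - (2 * u) • transMatrix G).det := by
  set S := G.dartReversalMatrix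
  set A := G.dartOriginMatrix
  set B := G.dartTerminusMatrix
  set c := 1 - u ^ 2
  have hSS : (1 + u • S) * (1 - u • S) = c • 1 := by
    rw [add_mul, mul_sub, mul_sub, smul_mul_smul_comm, G.dartReversalMatrix_mul_self, one_mul,
      one_mul, mul_one, sub_smul, one_smul, sq]
    abel
  have hfac : 1 - u • groverMatrix G =
      (1 + u • S) * (1 - ((c⁻¹ * u) • ((1 - u • S) * A)) * B) := by
    rw [Matrix.mul_sub, Matrix.mul_one, Matrix.smul_mul, Matrix.mul_smul, Matrix.mul_assoc _ A B,
      ← Matrix.mul_assoc, hSS, Matrix.smul_mul, Matrix.one_mul, smul_smul, mul_right_comm,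
      inv_mul_cancel₀ hu, one_mul, G.groverMatrix_eq_sub, smul_sub]
    abel
  have hvert : 1 - B * ((c⁻¹ * u) • ((1 - u • S) * A)) =
      c⁻¹ • ((1 + u ^ 2) • (1 : Matrix V V ℂ) - (2 * u) • transMatrix G) := by
    rw [Matrix.mul_smul, Matrix.sub_mul, Matrix.mul_sub, Matrix.one_mul, Matrix.smul_mul,
      Matrix.mul_smul, G.dartTerminusMatrix_mul_reversal_mul_origin hdeg,
      G.dartTerminusMatrix_mul_dartOriginMatrix]
    ext v w
    simp only [Matrix.sub_apply, Matrix.smul_apply, smul_eq_mul]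
    field_simp
    ring
  rw [hfac, det_mul, det_one_sub_mul_comm, hvert, det_smul, G.det_one_add_smul_dartReversalMatrix,
    zpow_sub₀ hu, zpow_natCast, zpow_natCast, inv_pow, div_eq_mul_inv, mul_assoc]

theorem det_one_sub_smul_groverMatrix_eq_zero [Nonempty V] (hdeg : ∀ v, G.degree v ≠ 0) {u : ℂ}
    (c : V → ℂ) (hc : ∀ v, c v ≠ 0) (h : ∀ v w, G.Adj v w → c w = u * c v) :
    (1 - u • groverMatrix G).det = 0 := by
  rw [← exists_mulVec_eq_zero_iff]
  refine ⟨fun e => c e.snd, fun h0 => ?_, ?_⟩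
  · obtain ⟨v⟩ := ‹Nonempty V›
    obtain ⟨w, hw⟩ := (G.degree_pos_iff_exists_adj v).1 (Nat.pos_of_ne_zero (hdeg v))
    exact hc w (congrFun h0 ⟨(v, w), hw⟩)
  · ext e
    have hd : (G.degree e.fst : ℂ) ≠ 0 := by exact_mod_cast hdeg e.fst
    have hB : (G.dartTerminusMatrix *ᵥ fun f => c f.snd) = fun v => 2 * c v := by
      ext v
      have hd : (G.degree v : ℂ) ≠ 0 := by exact_mod_cast hdeg v
      have : ∀ f : G.Dart, (if f.snd = v then 2 / (G.degree v : ℂ) else 0) * c f.snd =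
          if f.snd = v then 2 / (G.degree v : ℂ) * c v else 0 := by
        intro f
        split_ifs with hf
        · rw [hf]
        · rw [zero_mul]
      simp only [mulVec, dotProduct, dartTerminusMatrix, this]
      rw [← Finset.sum_filter, Finset.sum_const, card_filter_dart_snd, nsmul_eq_mul]
      field_simp
    have hA : (G.dartOriginMatrix *ᵥ fun v => 2 * c v) e = 2 * c e.fst := by
      simp [mulVec, dotProduct, dartOriginMatrix]
    have hS : (G.dartReversalMatrix *ᵥ fun f => c f.snd) e = c e.fst := by
      simp [mulVec, dotProduct, dartReversalMatrix]
    rw [sub_mulVec, one_mulVec, smul_mulVec, G.groverMatrix_eq_sub, sub_mulVec, ← mulVec_mulVec, hB]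
    simp only [Pi.sub_apply, Pi.smul_apply, smul_eq_mul, hA, hS, Pi.zero_apply]
    rw [h _ _ e.adj]
    ring

theorem det_one_sub_smul_groverMatrix_of_card_le (hdeg : ∀ v, G.degree v ≠ 0)
    (hle : Fintype.card V ≤ G.edgeFinset.card) (u : ℂ) :
    (1 - u • groverMatrix G).det = (1 - u ^ 2) ^ (G.edgeFinset.card - Fintype.card V) *
      ((1 + u ^ 2) • (1 : Matrix V V ℂ) - (2 * u) • transMatrix G).det := by
  have hdense : Dense ({1, -1}ᶜ : Set ℂ) := ((Set.toFinite {1, -1}).countable).dense_compl ℂ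
  refine congrFun (Continuous.ext_on hdense (f := fun u : ℂ => (1 - u • groverMatrix G).det)
    (g := fun u : ℂ => (1 - u ^ 2) ^ (G.edgeFinset.card - Fintype.card V) *
      ((1 + u ^ 2) • (1 : Matrix V V ℂ) - (2 * u) • transMatrix G).det)
    (by fun_prop) (by fun_prop) fun z hz => ?_) u
  have hz' : 1 - z ^ 2 ≠ 0 := fun h => hz (by simpa using (sub_eq_zero.1 h).symm)
  simp only
  rw [G.det_one_sub_smul_groverMatrix_of_ne_zero hdeg hz', ← Nat.cast_sub hle, zpow_natCast]

theorem IsTree.det_one_sub_smul_groverMatrix_eq_zero {G : SimpleGraph V} [DecidableRel G.Adj]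
    (hG : G.IsTree) (hdeg : ∀ v, G.degree v ≠ 0) {u : ℂ} (hu : 1 - u ^ 2 = 0) :
    (1 - u • groverMatrix G).det = 0 := by
  have : Nonempty V := hG.connected.nonempty
  have huu : u * u = 1 := by linear_combination -hu
  have hu0 : u ≠ 0 := by
    rintro rfl
    simp at huu
  refine G.det_one_sub_smul_groverMatrix_eq_zero hdeg
    (fun v => if hG.coloringTwo v = 0 then 1 else u) (fun v => ?_) fun v w hvw => ?_
  · split_ifs
    · exact one_ne_zero
    · exact hu0
  · have hne := hG.coloringTwo.valid hvw
    split_ifs with h1 h2 h2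
    · exact absurd (h2.trans h1.symm) hne
    · exact huu.symm
    · rw [mul_one]
    · omega

end GroverMatrix

end SimpleGraph

/-- For a finite connected simple graph `G` with `n` vertices and `m` edges, and any `u ∈ ℂ`,
`det(I_{2m} - u U) = (1 - u²)^(m - n) · det((1 + u²) I_n - 2u T(G))`,
where the exponent `m - n` is an integer (possibly `-1`, for a tree). -/
theorem grover_det_one_sub_smul {V : Type*} [Fintype V] [DecidableEq V]
    (G : SimpleGraph V) [DecidableRel G.Adj]
    (hG : G.Connected) (hV : 2 ≤ Fintype.card V)
    (n m : ℕ) (hn : n = Fintype.card V) (hm : m = G.edgeFinset.card) (u : ℂ) :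
    Matrix.det ((1 : Matrix G.Dart G.Dart ℂ) - u • groverMatrix G) =
      (1 - u ^ 2) ^ ((m : ℤ) - (n : ℤ)) *
        Matrix.det ((1 + u ^ 2) • (1 : Matrix V V ℂ) - (2 * u) • transMatrix G) := by
  subst hn hm
  have : Nontrivial V := Fintype.one_lt_card_iff_nontrivial.1 hV
  have hdeg : ∀ v, G.degree v ≠ 0 := fun v =>
    (hG.preconnected.degree_pos_of_nontrivial v).ne'
  by_cases hu : 1 - u ^ 2 = 0
  · rcases le_or_gt (Fintype.card V) G.edgeFinset.card with hle | hlt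
    · rw [G.det_one_sub_smul_groverMatrix_of_card_le hdeg hle, ← Nat.cast_sub hle, zpow_natCast]
    · have hcard : Nat.card G.edgeSet = G.edgeFinset.card := by
        rw [Nat.card_eq_fintype_card, SimpleGraph.edgeFinset_card]
      have hle := hG.card_vert_le_card_edgeSet_add_one
      rw [hcard, Nat.card_eq_fintype_card] at hle
      have hT : G.IsTree := by
        rw [SimpleGraph.isTree_iff_connected_and_card, hcard, Nat.card_eq_fintype_card]
        exact ⟨hG, by omega⟩
      rw [hT.det_one_sub_smul_groverMatrix_eq_zero hdeg hu, hu, zero_zpow _ (by omega), zero_mul]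
  · exact G.det_one_sub_smul_groverMatrix_of_ne_zero hdeg hu
end

section
/- Let n ≥ 3 and let C_n be the cycle graph on n vertices, with Grover matrix U_n (a 2n×2n matrix, since C_n has n edges). Then for every complex number u, det(I_{2n} − u U_n) = (1 − u^n)². -/
open SimpleGraph

/-- A permutation of `Fin (m + 2)` moving every point by `0` or `1` is the identity or the full
rotation. -/
lemma perm_eq_one_or_finRotate {m : ℕ} (σ : Equiv.Perm (Fin (m + 2)))
    (h : ∀ i, σ i = i ∨ σ i = i + 1) : σ = 1 ∨ σ = finRotate (m + 2) := by
  by_cases h1 : ∀ i, σ i = i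
  · exact Or.inl (Equiv.ext h1)
  · right
    push Not at h1
    obtain ⟨i₀, hi₀⟩ := h1
    have step : ∀ i, σ i ≠ i → σ (i + 1) ≠ i + 1 := by
      intro i hi hi'
      have h2 := σ.injective (hi'.trans ((h i).resolve_left hi).symm)
      simp at h2
    have all : ∀ j : Fin (m + 2), σ (i₀ + j) ≠ i₀ + j := by
      intro j
      induction j using Fin.induction with
      | zero => simpa using hi₀
      | succ j ih =>
        rw [← Fin.coeSucc_eq_succ, ← add_assoc]
        exact step _ ih
    ext1 i
    rw [finRotate_apply]
    refine (h i).resolve_left ?_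
    simpa using all (i - i₀)

/-- The reversed characteristic polynomial of a cyclic shift. -/
lemma det_one_sub_smul_cyclicShift {R : Type*} [CommRing R] (m : ℕ) (u : R) :
    Matrix.det (1 - u • Matrix.of fun i j : Fin (m + 2) => if i = j + 1 then (1 : R) else 0)
      = 1 - u ^ (m + 2) := by
  rw [Matrix.det_apply, Finset.sum_eq_add (1 : Equiv.Perm (Fin (m + 2))) (finRotate (m + 2))]
  · simp [sign_finRotate, Finset.prod_const, Units.smul_def]
    rw [neg_pow u, ← mul_assoc, ← pow_add, Odd.neg_one_pow (by exact ⟨m + 1, by ring⟩)]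
    ring
  · intro h
    simpa using congrArg (fun σ => σ 0) h
  · rintro σ - ⟨h1, h2⟩
    have hσ : ¬ ∀ i, σ i = i ∨ σ i = i + 1 := fun h =>
      (perm_eq_one_or_finRotate σ h).elim h1 h2
    push Not at hσ
    obtain ⟨i, hi, hi'⟩ := hσ
    rw [Finset.prod_eq_zero (Finset.mem_univ i), smul_zero]
    simp [hi, hi']
  · simp
  · simp

lemma Fin.add_one_add_one_ne_self {m : ℕ} (i : Fin (m + 3)) : i + 1 + 1 ≠ i := by
  rw [ne_eq, add_assoc, add_eq_left]
  exact ne_of_beq_false rfl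

lemma Fin.sub_one_sub_one_ne_self {m : ℕ} (i : Fin (m + 3)) : i - 1 - 1 ≠ i := by
  intro h
  apply Fin.add_one_add_one_ne_self i
  rw [sub_eq_iff_eq_add, sub_eq_iff_eq_add] at h
  exact h.symm

/-- The darts of a cycle graph are the `(i, i + 1)` and the `(i, i - 1)`. -/
noncomputable def cycleGraphDartEquiv (m : ℕ) : Fin (m + 3) ⊕ Fin (m + 3) ≃ (cycleGraph (m + 3)).Dart :=
  Equiv.ofBijective
    (Sum.elim (fun i => ⟨(i, i + 1), by simp [cycleGraph_adj]⟩)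
      (fun i => ⟨(i, i - 1), by simp [cycleGraph_adj]⟩)) <| by
    constructor
    · rintro (i | i) (j | j) h <;> simp [Dart.ext_iff] at h ⊢
      · exact h
      · obtain ⟨rfl, h⟩ := h
        exact Fin.add_one_add_one_ne_self _ (eq_sub_iff_add_eq.1 h)
      · obtain ⟨rfl, h⟩ := h
        exact Fin.sub_one_sub_one_ne_self _ (sub_eq_iff_eq_add.2 h)
      · exact h
    · rintro ⟨⟨a, b⟩, h⟩
      rcases (cycleGraph_adj.1 h) with h | h
      · refine ⟨Sum.inr a, ?_⟩
        simp [← h]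
      · refine ⟨Sum.inl a, ?_⟩
        simp [← h]

@[simp]
lemma cycleGraphDartEquiv_inl_toProd (m : ℕ) (i : Fin (m + 3)) :
    (cycleGraphDartEquiv m (Sum.inl i)).toProd = (i, i + 1) := rfl

@[simp]
lemma cycleGraphDartEquiv_inr_toProd (m : ℕ) (i : Fin (m + 3)) :
    (cycleGraphDartEquiv m (Sum.inr i)).toProd = (i, i - 1) := rfl

/-- In the orientation-wise dart basis the Grover matrix of a cycle is a pair of opposite cyclic
shifts. -/
lemma groverMatrix_cycleGraph_submatrix (m : ℕ) :
    let S : Matrix (Fin (m + 3)) (Fin (m + 3)) ℂ := Matrix.of fun i j => if i = j + 1 then 1 else 0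
    (groverMatrix (cycleGraph (m + 3))).submatrix (cycleGraphDartEquiv m) (cycleGraphDartEquiv m)
      = Matrix.fromBlocks S 0 0 S.transpose := by
  have hU (e f : (cycleGraph (m + 3)).Dart) : groverMatrix (cycleGraph (m + 3)) e f =
      if f = e.symm then 0 else if f.snd = e.fst then 1 else 0 := by
    simp [groverMatrix, cycleGraph_degree_three_le]
  ext (i | i) (j | j)
  · have : ¬ (j = i + 1 ∧ j + 1 = i) := by
      rintro ⟨rfl, h⟩
      exact Fin.add_one_add_one_ne_self _ h
    simp [hU, Dart.ext_iff, Prod.ext_iff, this,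
      eq_comm (a := i)]
    congr
  · have : (j = i + 1 ∧ j - 1 = i) ↔ j - 1 = i := by grind
    simp [hU, Dart.ext_iff, Prod.ext_iff, this]
    exact fun h => if_neg h
  · have : (j = i - 1 ∧ j + 1 = i) ↔ j + 1 = i := by grind
    simp [hU, Dart.ext_iff, Prod.ext_iff, this]
    exact fun h => if_neg h
  · have : ¬ (j = i - 1 ∧ j = i + 1) := by
      rintro ⟨rfl, h⟩
      exact Fin.sub_one_sub_one_ne_self _ (sub_eq_iff_eq_add.2 h)
    simp [hU, Dart.ext_iff, Prod.ext_iff, this,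
      sub_eq_iff_eq_add]

/-- For the cycle graph `Cₙ` (`n ≥ 3`) with Grover matrix `Uₙ` (a `2n × 2n` matrix),
`det(I - u Uₙ) = (1 - uⁿ)²` for every complex number `u`. -/
theorem grover_det_cycleGraph (n : ℕ) (hn : 3 ≤ n) (u : ℂ) :
    Matrix.det ((1 : Matrix (cycleGraph n).Dart (cycleGraph n).Dart ℂ)
        - u • groverMatrix (cycleGraph n)) = (1 - u ^ n) ^ 2 := by
  obtain ⟨m, rfl⟩ := Nat.exists_eq_add_of_le' hn
  rw [← Matrix.det_submatrix_equiv_self (cycleGraphDartEquiv m), Matrix.submatrix_sub,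
    Pi.sub_apply, Pi.sub_apply, Matrix.submatrix_smul, Pi.smul_apply, Pi.smul_apply,
    Matrix.submatrix_one_equiv, groverMatrix_cycleGraph_submatrix, ← Matrix.fromBlocks_one,
    Matrix.fromBlocks_smul, sub_eq_add_neg, Matrix.fromBlocks_neg, Matrix.fromBlocks_add, smul_zero,
    neg_zero, add_zero, ← sub_eq_add_neg, ← sub_eq_add_neg,
    Matrix.det_fromBlocks_zero₂₁, ← Matrix.det_transpose (1 - u • Matrix.transpose _),
    Matrix.transpose_sub, Matrix.transpose_smul, Matrix.transpose_transpose, Matrix.transpose_one,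
    det_one_sub_smul_cyclicShift (m + 1) u, sq]
end

section
/- For every real number u with |u| ≠ 1, exp( (1/(2π)) ∫₀^{2π} log((1 + u²) − 2u cos x) dx ) = (u² + 1 + |u² − 1|)/2. Equivalently, ∫₀^{2π} log(1 − 2u cos x + u²) dx = 0 if |u| < 1, and equals 2π·log(u²) if |u| > 1. -/
/-- Jensen's formula for a linear factor, written with an explicit integral over the angle. -/
lemma integral_log_one_sub_two_mul_cos_eq_posLog (u : ℝ) :
    ∫ x in (0 : ℝ)..(2 * Real.pi), Real.log (1 - 2 * u * Real.cos x + u ^ 2) =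
      4 * Real.pi * Real.posLog u := by
  have havg := circleAverage_log_norm_sub_const_eq_posLog (a := (u : ℂ))
  rw [Real.circleAverage_def, smul_eq_mul, Complex.norm_real, Real.norm_eq_abs, Real.posLog_abs]
    at havg
  have hlog (x : ℝ) : Real.log (1 - 2 * u * Real.cos x + u ^ 2) =
      2 * Real.log ‖circleMap 0 1 x - (u : ℂ)‖ := by
    have hsq : 1 - 2 * u * Real.cos x + u ^ 2 = ‖circleMap 0 1 x - (u : ℂ)‖ ^ 2 := by
      rw [← Complex.normSq_eq_norm_sq, Complex.normSq_apply]
      simp only [circleMap, Complex.ofReal_one, one_mul, zero_add, Complex.sub_re, Complex.sub_im,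
        Complex.exp_ofReal_mul_I_re, Complex.exp_ofReal_mul_I_im, Complex.ofReal_re,
        Complex.ofReal_im]
      linear_combination -Real.sin_sq_add_cos_sq x
    rw [hsq, Real.log_pow, Nat.cast_ofNat]
  simp_rw [hlog]
  rw [intervalIntegral.integral_const_mul]
  have hpi := Real.pi_ne_zero
  field_simp at havg
  linear_combination 2 * havg

/-- For every real `u` with `|u| ≠ 1`,
`exp((1/2π) ∫₀^{2π} log((1 + u²) - 2u cos x) dx) = (u² + 1 + |u² - 1|)/2`;
equivalently, `∫₀^{2π} log(1 - 2u cos x + u²) dx` equals `0` if `|u| < 1` and equals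
`2π log(u²)` if `|u| > 1`. -/
theorem integral_log_one_sub_two_mul_cos (u : ℝ) (hu : |u| ≠ 1) :
    Real.exp ((1 / (2 * Real.pi)) *
        ∫ x in (0 : ℝ)..(2 * Real.pi), Real.log ((1 + u ^ 2) - 2 * u * Real.cos x)) =
      (u ^ 2 + 1 + |u ^ 2 - 1|) / 2 ∧
    (|u| < 1 →
      (∫ x in (0 : ℝ)..(2 * Real.pi), Real.log (1 - 2 * u * Real.cos x + u ^ 2)) = 0) ∧
    (1 < |u| →
      (∫ x in (0 : ℝ)..(2 * Real.pi), Real.log (1 - 2 * u * Real.cos x + u ^ 2)) =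
        2 * Real.pi * Real.log (u ^ 2)) := by
  have hform : ∫ x in (0 : ℝ)..(2 * Real.pi), Real.log ((1 + u ^ 2) - 2 * u * Real.cos x) =
      4 * Real.pi * Real.posLog u := by
    rw [← integral_log_one_sub_two_mul_cos_eq_posLog u]
    congr with x
    ring_nf
  rw [hform, integral_log_one_sub_two_mul_cos_eq_posLog]
  have hexponent : 1 / (2 * Real.pi) * (4 * Real.pi * Real.posLog u) = 2 * Real.posLog u := by
    field_simp
    norm_num
  rw [hexponent]
  rcases hu.lt_or_gt with h | h
  · have hzero : Real.posLog u = 0 := Real.posLog_eq_zero_iff u |>.2 h.le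
    have hsq : u ^ 2 < 1 := (sq_lt_one_iff_abs_lt_one u).2 h
    refine ⟨?_, fun _ ↦ by rw [hzero, mul_zero], fun h' ↦ absurd h h'.not_gt⟩
    rw [hzero, mul_zero, Real.exp_zero, abs_of_neg (by linarith)]
    ring
  · have hlog : 2 * Real.posLog u = Real.log (u ^ 2) := by
      rw [Real.posLog_eq_log h.le, Real.log_pow, Nat.cast_ofNat]
    have hsq : 1 < u ^ 2 := (one_lt_sq_iff_one_lt_abs u).2 h
    refine ⟨?_, fun h' ↦ absurd h h'.not_gt, fun _ ↦ by rw [← hlog]; ring⟩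
    rw [hlog, Real.exp_log (by linarith), abs_of_pos (by linarith)]
    ring
end

section
/- Let u be a real number with |u| < 1, and for n ≥ 3 let ζ_{C_n}(u) = exp(∑_{m≥1} (N⁰_m(C_n)/m) u^m) be the generalized Ihara zeta function of the cycle graph C_n based at a fixed vertex. Then lim_{n→∞} ζ_{C_n}(u)^{−1} = exp( (1/(2π)) ∫₀^{2π} log((1 − 2u + u²) + 2u(1 − cos x)) dx ). -/
open SimpleGraph Filter

/-- A family `c : ZMod m → G.Dart` is a cycle (closed path of arcs) of length `m`:
consecutive darts are composable, cyclically. -/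
def IsCycleSeq {V : Type*} (G : SimpleGraph V) {m : ℕ} (c : ZMod m → G.Dart) : Prop :=
  ∀ i : ZMod m, (c i).snd = (c (i + 1)).fst

/-- A cycle is reduced if it has no backtracking and no tail; cyclically this reads
`e_{i+1} ≠ e_i⁻¹` for all `i ∈ ℤ/m`. -/
def IsReducedCycleSeq {V : Type*} (G : SimpleGraph V) {m : ℕ} (c : ZMod m → G.Dart) : Prop :=
  IsCycleSeq G c ∧ ∀ i : ZMod m, c (i + 1) ≠ (c i).symm

/-- `N⁰_m`: the number of reduced cycles of length `m` in `G` based at the vertex `x₀`. -/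
noncomputable def numReducedCyclesAt {V : Type*} (G : SimpleGraph V) (x₀ : V) (m : ℕ) : ℕ :=
  Nat.card {c : ZMod m → G.Dart // IsReducedCycleSeq G c ∧ (c 0).fst = x₀}

/-- The generalized Ihara zeta function `ζ_G(u) = exp(∑_{m ≥ 1} (N⁰_m / m) u^m)` of `G`
based at `x₀`, evaluated at a real number `u`. -/
noncomputable def genZetaFnReal {V : Type*} (G : SimpleGraph V) (x₀ : V) (u : ℝ) : ℝ :=
  Real.exp (∑' m : ℕ,
    if m = 0 then 0 else (numReducedCyclesAt G x₀ m : ℝ) / m * u ^ m)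

theorem cycleGraph_dart_snd_sub_fst {n : ℕ} (d : (cycleGraph (n + 3)).Dart) :
    d.snd - d.fst = 1 ∨ d.snd - d.fst = -1 := by
  rcases cycleGraph_adj.1 d.adj with h | h
  · exact Or.inr (by rw [← h, neg_sub])
  · exact Or.inl h

/-- Along a reduced cycle of a cycle graph the step `snd - fst` never changes. -/
theorem IsReducedCycleSeq.step_add_one {n m : ℕ} {c : ZMod m → (cycleGraph (n + 3)).Dart}
    (hc : IsReducedCycleSeq _ c) (i : ZMod m) :
    (c (i + 1)).snd - (c (i + 1)).fst = (c i).snd - (c i).fst := by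
  by_contra hne
  have hsum : (c (i + 1)).snd - (c (i + 1)).fst = -((c i).snd - (c i).fst) := by
    rcases cycleGraph_dart_snd_sub_fst (c i) with h | h <;>
      rcases cycleGraph_dart_snd_sub_fst (c (i + 1)) with h' | h' <;>
      simp_all
  have hfst := hc.1 i
  refine hc.2 i (SimpleGraph.Dart.ext _ _ (Prod.ext hfst.symm ?_))
  rw [← hfst, neg_sub] at hsum
  exact sub_left_inj.1 hsum

theorem IsReducedCycleSeq.step_natCast {n m : ℕ} {c : ZMod m → (cycleGraph (n + 3)).Dart}
    (hc : IsReducedCycleSeq _ c) (k : ℕ) :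
    (c k).snd - (c k).fst = (c 0).snd - (c 0).fst := by
  induction k with
  | zero => simp
  | succ k ih => rw [Nat.cast_succ, hc.step_add_one, ih]

theorem IsReducedCycleSeq.fst_natCast {n m : ℕ} {c : ZMod m → (cycleGraph (n + 3)).Dart}
    (hc : IsReducedCycleSeq _ c) (k : ℕ) :
    (c k).fst = (c 0).fst + k • ((c 0).snd - (c 0).fst) := by
  induction k with
  | zero => simp
  | succ k ih =>
    rw [Nat.cast_succ, ← hc.1, ← sub_add_cancel (c k).snd (c k).fst, hc.step_natCast, ih,
      succ_nsmul]
    abel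

theorem Fin.val_nsmul_one (n k : ℕ) : (k • (1 : Fin (n + 3))).val = k % (n + 3) := by
  induction k with
  | zero => simp
  | succ k ih => rw [succ_nsmul, Fin.val_add, ih]; simp

theorem IsReducedCycleSeq.dvd_length {n m : ℕ} {c : ZMod m → (cycleGraph (n + 3)).Dart}
    (hc : IsReducedCycleSeq _ c) : n + 3 ∣ m := by
  have h := hc.fst_natCast m
  rw [ZMod.natCast_self, left_eq_add] at h
  have h1 : m • (1 : Fin (n + 3)) = 0 := by
    rcases cycleGraph_dart_snd_sub_fst (c 0) with hs | hs <;> rw [hs] at h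
    · exact h
    · rwa [neg_nsmul, neg_eq_zero] at h
  exact Nat.dvd_of_mod_eq_zero (by rw [← Fin.val_nsmul_one, h1, Fin.val_zero])

theorem IsReducedCycleSeq.ext_zero {n m : ℕ} (hm : m ≠ 0)
    {c d : ZMod m → (cycleGraph (n + 3)).Dart} (hc : IsReducedCycleSeq _ c)
    (hd : IsReducedCycleSeq _ d) (h : c 0 = d 0) : c = d := by
  have : NeZero m := ⟨hm⟩
  funext i
  obtain ⟨k, rfl⟩ := ZMod.natCast_zmod_surjective i
  have hfst : (c k).fst = (d k).fst := by rw [hc.fst_natCast, hd.fst_natCast, h]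
  refine SimpleGraph.Dart.ext _ _ (Prod.ext hfst ?_)
  have hstep := hc.step_natCast k
  rw [h, ← hd.step_natCast k, hfst] at hstep
  exact sub_left_inj.1 hstep

theorem numReducedCyclesAt_cycleGraph_eq_zero {n m : ℕ} (x : Fin (n + 3)) (h : ¬ n + 3 ∣ m) :
    numReducedCyclesAt (cycleGraph (n + 3)) x m = 0 := by
  have : IsEmpty {c : ZMod m → (cycleGraph (n + 3)).Dart //
      IsReducedCycleSeq _ c ∧ (c 0).fst = x} := ⟨fun c => h c.2.1.dvd_length⟩
  exact Nat.card_of_isEmpty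

theorem numReducedCyclesAt_cycleGraph_le_two {n m : ℕ} (x : Fin (n + 3)) (hm : m ≠ 0) :
    numReducedCyclesAt (cycleGraph (n + 3)) x m ≤ 2 := by
  let f : {c : ZMod m → (cycleGraph (n + 3)).Dart //
      IsReducedCycleSeq _ c ∧ (c 0).fst = x} → Bool :=
    fun c => decide ((c.1 0).snd - (c.1 0).fst = 1)
  have hf : Function.Injective f := by
    rintro ⟨c, hc, hcx⟩ ⟨d, hd, hdx⟩ hcd
    have hiff := decide_eq_decide.1 hcd
    have hstep : (c 0).snd - (c 0).fst = (d 0).snd - (d 0).fst := by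
      by_cases h1 : (c 0).snd - (c 0).fst = 1
      · rw [h1, hiff.1 h1]
      · rw [(cycleGraph_dart_snd_sub_fst (c 0)).resolve_left h1,
          (cycleGraph_dart_snd_sub_fst (d 0)).resolve_left (mt hiff.2 h1)]
    rw [hcx, hdx] at hstep
    exact Subtype.ext (hc.ext_zero hm hd
      (SimpleGraph.Dart.ext _ _ (Prod.ext (hcx.trans hdx.symm) (sub_left_inj.1 hstep))))
  simpa [numReducedCyclesAt] using Nat.card_le_card_of_injective f hf

theorem integral_log_poisson_denominator_eq_zero {u : ℝ} (hu : |u| < 1) :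
    ∫ x in (0 : ℝ)..(2 * Real.pi),
      Real.log ((1 - 2 * u + u ^ 2) + 2 * u * (1 - Real.cos x)) = 0 := by
  have h := circleAverage_log_norm_sub_const₀ (a := (u : ℂ)) (by simpa using hu)
  rw [Real.circleAverage_def, smul_eq_zero_iff_right (by positivity)] at h
  have hlog (x : ℝ) : Real.log ((1 - 2 * u + u ^ 2) + 2 * u * (1 - Real.cos x)) =
      2 * Real.log ‖circleMap 0 1 x - u‖ := by
    have hsq : (1 - 2 * u + u ^ 2) + 2 * u * (1 - Real.cos x) = ‖circleMap 0 1 x - u‖ ^ 2 := by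
      rw [← Complex.normSq_eq_norm_sq, Complex.normSq_apply]
      simp [circleMap, Complex.exp_ofReal_mul_I_re, Complex.exp_ofReal_mul_I_im]
      linear_combination -Real.sin_sq_add_cos_sq x
    rw [hsq, Real.log_pow, Nat.cast_ofNat]
  simp_rw [hlog, intervalIntegral.integral_const_mul, h, mul_zero]

/-- For real `u` with `|u| < 1`, the inverses of the generalized Ihara zeta functions of the
cycle graphs `Cₙ` (based at the vertex `0`) converge, as `n → ∞` (here `n + 3` ranges over
all integers `≥ 3`), to `exp((1/2π) ∫₀^{2π} log((1 - 2u + u²) + 2u(1 - cos x)) dx)`. -/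
theorem genZeta_cycleGraph_inv_tendsto (u : ℝ) (hu : |u| < 1) :
    Tendsto (fun n : ℕ => (genZetaFnReal (cycleGraph (n + 3)) (0 : Fin (n + 3)) u)⁻¹)
      atTop
      (nhds (Real.exp ((1 / (2 * Real.pi)) *
        ∫ x in (0 : ℝ)..(2 * Real.pi),
          Real.log ((1 - 2 * u + u ^ 2) + 2 * u * (1 - Real.cos x))))) := by
  rw [integral_log_poisson_denominator_eq_zero hu, mul_zero]
  simp only [genZetaFnReal, ← Real.exp_neg]
  refine (Real.continuous_exp.tendsto 0).comp ?_
  suffices h : Tendsto (fun n : ℕ => ∑' m : ℕ, if m = 0 then 0 else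
      (numReducedCyclesAt (cycleGraph (n + 3)) (0 : Fin (n + 3)) m : ℝ) / m * u ^ m)
      atTop (nhds (∑' _ : ℕ, 0)) by
    simpa only [tsum_zero, neg_zero] using h.neg
  refine tendsto_tsum_of_dominated_convergence (bound := fun m => 2 * |u| ^ m)
    ((summable_geometric_of_lt_one (abs_nonneg u) hu).mul_left 2) (fun m => ?_)
    (Eventually.of_forall fun n m => ?_)
  · refine tendsto_const_nhds.congr' ?_
    filter_upwards [eventually_ge_atTop m] with n hn
    split_ifs with hm
    · rfl
    · rw [numReducedCyclesAt_cycleGraph_eq_zero _ fun h => ?_]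
      · simp
      · have := Nat.le_of_dvd (Nat.pos_of_ne_zero hm) h
        omega
  · split_ifs with hm
    · simp
    · rw [norm_mul, norm_pow, Real.norm_eq_abs u, Real.norm_of_nonneg (by positivity)]
      gcongr
      have hN : (numReducedCyclesAt (cycleGraph (n + 3)) 0 m : ℝ) ≤ 2 := by
        exact_mod_cast numReducedCyclesAt_cycleGraph_le_two 0 hm
      exact (div_le_self (Nat.cast_nonneg _)
        (by exact_mod_cast Nat.one_le_iff_ne_zero.2 hm)).trans hN
end
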